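/- There exists f ∈ L̃²_{τ+1,b}(𝕋^n) whose Fourier coefficients satisfy ∑_{0≠k∈ℤ^n} |f_k|² |k|^{2([τ]+2)} = +∞; that is, f does not belong to H^{[τ]+2}(𝕋^n), so f does not admit weak (L²) derivatives of order [τ]+2. Concretely, any coefficient family with block sums Θ_ν := ∑_{b^{ν−1} < |k| ≤ b^ν} |f_k|² |k|^{2τ+2} ≍ ν^{−4} as ν → ∞ has this property. -/

import Mathlib

open scoped BigOperators ENNReal
open MeasureTheory

noncomputable section

/-- The ℓ¹ norm `|k| = ∑ |k_j|` of an integer vector `k ∈ ℤ^n`. -/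
def knorm {n : ℕ} (k : Fin n → ℤ) : ℝ := ∑ j, |(k j : ℝ)|

/-- The dyadic-type block sum `∑_{b^{ν-1} < |k| ≤ b^ν} F(k)² |k|^{2τ+2}`,
where `F k` plays the role of `|f_k|`. -/
def blockSum (n b : ℕ) (τ : ℝ) (F : (Fin n → ℤ) → ℝ) (ν : ℕ) : ℝ :=
  ∑' k : Fin n → ℤ,
    if (b : ℝ) ^ ((ν : ℤ) - 1) < knorm k ∧ knorm k ≤ (b : ℝ) ^ (ν : ℕ) then
      F k ^ 2 * knorm k ^ (2 * τ + 2) else 0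

theorem knorm_nonneg {n : ℕ} (k : Fin n → ℤ) : 0 ≤ knorm k :=
  Finset.sum_nonneg fun _ _ => abs_nonneg _

theorem knorm_single {n : ℕ} (i : Fin n) (m : ℤ) :
    knorm (Pi.single i m : Fin n → ℤ) = |(m : ℝ)| := by
  unfold knorm
  rw [Finset.sum_eq_single i]
  · simp
  · intro j _ hj
    simp [Pi.single_eq_of_ne hj]
  · simp

/-- Block sums that are `O(ν⁻⁴)` have summable square roots. -/
theorem summable_sqrt_of_eventually_le (u : ℕ → ℝ) (C : ℝ)
    (h : ∀ᶠ ν : ℕ in Filter.atTop, u ν ≤ C / (ν : ℝ) ^ 4) :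
    Summable fun ν : ℕ => Real.sqrt (u ν) := by
  have hs : Summable fun ν : ℕ => Real.sqrt C * (1 / (ν : ℝ) ^ 2) :=
    (Real.summable_one_div_nat_pow.mpr one_lt_two).mul_left _
  refine Summable.of_norm_bounded_eventually_nat hs ?_
  filter_upwards [h] with ν hν
  rw [Real.norm_of_nonneg (Real.sqrt_nonneg _)]
  calc Real.sqrt (u ν) ≤ Real.sqrt (C / (ν : ℝ) ^ 4) := Real.sqrt_le_sqrt hν
    _ = Real.sqrt C * (1 / (ν : ℝ) ^ 2) := by
      rw [Real.sqrt_div' _ (by positivity), show (ν : ℝ) ^ 4 = ((ν : ℝ) ^ 2) ^ 2 by ring,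
        Real.sqrt_sq (by positivity)]
      ring

/-- A summable family with weight `|k|^s`, `s ≥ 2τ + 2`, has block sums that decay at
least like `b^{-ν(s - 2τ - 2)}`. -/
theorem blockSum_le_of_summable {n b : ℕ} (hb : 2 ≤ b) {τ s : ℝ} (hs : 2 * τ + 2 ≤ s)
    (F : (Fin n → ℤ) → ℝ) (hF : Summable fun k => F k ^ 2 * knorm k ^ s) (ν : ℕ) :
    blockSum n b τ F ν ≤
      ((b : ℝ) ^ ((ν : ℤ) - 1)) ^ (2 * τ + 2 - s) * ∑' k, F k ^ 2 * knorm k ^ s := by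
  have hb0 : (0 : ℝ) < b := by exact_mod_cast (by omega : 0 < b)
  have hB : 0 < (b : ℝ) ^ ((ν : ℤ) - 1) := zpow_pos hb0 _
  set B := (b : ℝ) ^ ((ν : ℤ) - 1)
  have hle : ∀ k : Fin n → ℤ,
      (if B < knorm k ∧ knorm k ≤ (b : ℝ) ^ ν then F k ^ 2 * knorm k ^ (2 * τ + 2) else 0) ≤
        B ^ (2 * τ + 2 - s) * (F k ^ 2 * knorm k ^ s) := by
    intro k
    have hk0 := knorm_nonneg k
    split_ifs with hk
    · have hkpos : 0 < knorm k := hB.trans hk.1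
      have h1 : knorm k ^ (2 * τ + 2) = knorm k ^ (2 * τ + 2 - s) * knorm k ^ s := by
        rw [← Real.rpow_add hkpos]; ring_nf
      have h2 : knorm k ^ (2 * τ + 2 - s) ≤ B ^ (2 * τ + 2 - s) :=
        Real.rpow_le_rpow_of_nonpos hB hk.1.le (by linarith)
      rw [h1, mul_left_comm]
      gcongr
    · positivity
  have hsum := hF.mul_left (B ^ (2 * τ + 2 - s))
  rw [← tsum_mul_left]
  refine Summable.tsum_le_tsum hle (hsum.of_nonneg_of_le (fun k => ?_) hle) hsum
  have hk0 := knorm_nonneg k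
  split_ifs <;> positivity

/-- Block sums bounded below by `c ν⁻⁴` rule out summability with any weight `|k|^s`,
`s > 2τ + 2`. -/
theorem not_summable_of_blockSum_ge {n b : ℕ} (hb : 2 ≤ b) {τ s : ℝ} (hs : 2 * τ + 2 < s)
    (F : (Fin n → ℤ) → ℝ) {c : ℝ} (hc : 0 < c)
    (h : ∀ᶠ ν : ℕ in Filter.atTop, c / (ν : ℝ) ^ 4 ≤ blockSum n b τ F ν) :
    ¬ Summable fun k => F k ^ 2 * knorm k ^ s := by
  intro hF
  have hb1 : (1 : ℝ) < b := by exact_mod_cast (by omega : 1 < b)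
  have hb0 : (0 : ℝ) < b := by linarith
  set S := ∑' k, F k ^ 2 * knorm k ^ s
  set r : ℝ := (b : ℝ) ^ (s - (2 * τ + 2)) with hr
  have hr1 : 1 < r := Real.one_lt_rpow hb1 (by linarith)
  have hr0 : 0 < r := by linarith
  have hlim : Filter.Tendsto (fun ν : ℕ => r * S * ((ν : ℝ) ^ 4 / r ^ ν)) Filter.atTop
      (nhds (r * S * 0)) :=
    (tendsto_pow_const_div_const_pow_of_one_lt 4 hr1).const_mul _
  rw [mul_zero] at hlim
  refine absurd (ge_of_tendsto hlim ?_) (not_le.mpr hc)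
  filter_upwards [h, Filter.eventually_gt_atTop 0] with ν hν hν0
  have hpos : (0 : ℝ) < (ν : ℝ) ^ 4 := by positivity
  have hweight : ((b : ℝ) ^ ((ν : ℤ) - 1)) ^ (2 * τ + 2 - s) = r / r ^ ν := by
    rw [← Real.rpow_intCast, ← Real.rpow_mul hb0.le, ← Real.rpow_natCast, hr,
      ← Real.rpow_mul hb0.le, ← Real.rpow_sub hb0]
    congr 1
    push_cast
    ring
  have hle := hν.trans (blockSum_le_of_summable hb hs.le F hF ν)
  rw [hweight, div_le_iff₀ hpos] at hle
  calc c ≤ r / r ^ ν * S * (ν : ℝ) ^ 4 := hle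
    _ = r * S * ((ν : ℝ) ^ 4 / r ^ ν) := by ring

/-- A lacunary family supported on the vectors `(b^ν, 0, …, 0)` realises any nonnegative
sequence of block sums. -/
theorem exists_blockSum_eq {n b : ℕ} (hn : 0 < n) (hb : 2 ≤ b) (τ : ℝ) (u : ℕ → ℝ)
    (hu : ∀ ν, 0 ≤ u ν) :
    ∃ f : (Fin n → ℤ) → ℂ, ∀ ν, blockSum n b τ (fun k => ‖f k‖) ν = u ν := by
  have hb1 : (1 : ℝ) < b := by exact_mod_cast (by omega : 1 < b)
  have hb0 : (0 : ℝ) < b := by linarith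
  let e : ℕ → Fin n → ℤ := fun ν => Pi.single ⟨0, hn⟩ ((b : ℤ) ^ ν)
  have hnorm : ∀ ν, knorm (e ν) = (b : ℝ) ^ ν := by
    intro ν
    simp only [e]
    rw [knorm_single]
    push_cast
    exact abs_of_pos (by positivity)
  have he : Function.Injective e := by
    intro p q hpq
    have h := congrArg knorm hpq
    rw [hnorm, hnorm] at h
    exact pow_right_injective₀ hb0 hb1.ne' h
  let f : (Fin n → ℤ) → ℂ := Function.extend e
    (fun ν => ((Real.sqrt (u ν / ((b : ℝ) ^ ν) ^ (2 * τ + 2)) : ℝ) : ℂ)) 0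
  refine ⟨f, fun ν => ?_⟩
  unfold blockSum
  rw [tsum_eq_single (e ν)]
  · have hfe : ‖f (e ν)‖ ^ 2 = u ν / ((b : ℝ) ^ ν) ^ (2 * τ + 2) := by
      simp only [f]
      rw [he.extend_apply, Complex.norm_real, Real.norm_of_nonneg (Real.sqrt_nonneg _),
        Real.sq_sqrt (div_nonneg (hu ν) (by positivity))]
    have hlt : (b : ℝ) ^ ((ν : ℤ) - 1) < (b : ℝ) ^ ν := by
      rw [← zpow_natCast]
      exact zpow_lt_zpow_right₀ hb1 (by omega)
    rw [hnorm, if_pos ⟨hlt, le_rfl⟩, hfe, div_mul_cancel₀]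
    positivity
  · intro k hk
    split_ifs with hblock
    · by_cases hex : ∃ m, e m = k
      · obtain ⟨m, rfl⟩ := hex
        rw [hnorm, ← zpow_natCast, ← zpow_natCast, zpow_lt_zpow_iff_right₀ hb1,
          zpow_le_zpow_iff_right₀ hb1] at hblock
        exact absurd (congrArg e (by omega : m = ν)) hk
      · simp [f, Function.extend_apply' _ _ _ hex]
    · rfl

/-- There exists `f ∈ L̃²_{τ+1,b}(𝕋^n)` with
`∑_{k≠0} |f_k|²|k|^{2([τ]+2)} = +∞`, i.e. `f ∉ H^{[τ]+2}(𝕋^n)`; moreover any coefficient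
family whose block sums `Θ_ν` are `≍ ν^{-4}` as `ν → ∞` has this property. -/
theorem stmt9 (n b : ℕ) (hn : 2 ≤ n) (hb : 2 ≤ b) (τ : ℝ) (hτ : (n : ℝ) - 1 ≤ τ) :
    (∃ f : (Fin n → ℤ) → ℂ,
      (Summable fun ν : ℕ => Real.sqrt (blockSum n b τ (fun k => ‖f k‖) ν)) ∧
      ¬ Summable fun k : Fin n → ℤ =>
          ‖f k‖ ^ 2 * knorm k ^ ((2 * (⌊τ⌋₊ + 2) : ℕ) : ℝ)) ∧
    ∀ f : (Fin n → ℤ) → ℂ, ∀ c C : ℝ, 0 < c → 0 < C →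
      (∀ᶠ ν : ℕ in Filter.atTop,
        c / (ν : ℝ) ^ 4 ≤ blockSum n b τ (fun k => ‖f k‖) ν ∧
        blockSum n b τ (fun k => ‖f k‖) ν ≤ C / (ν : ℝ) ^ 4) →
      (Summable fun ν : ℕ => Real.sqrt (blockSum n b τ (fun k => ‖f k‖) ν)) ∧
      ¬ Summable fun k : Fin n → ℤ =>
          ‖f k‖ ^ 2 * knorm k ^ ((2 * (⌊τ⌋₊ + 2) : ℕ) : ℝ) := by
  have hs : 2 * τ + 2 < ((2 * (⌊τ⌋₊ + 2) : ℕ) : ℝ) := by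
    have := Nat.lt_floor_add_one τ
    push_cast
    linarith
  have key : ∀ f : (Fin n → ℤ) → ℂ, ∀ c C : ℝ, 0 < c → 0 < C →
      (∀ᶠ ν : ℕ in Filter.atTop,
        c / (ν : ℝ) ^ 4 ≤ blockSum n b τ (fun k => ‖f k‖) ν ∧
        blockSum n b τ (fun k => ‖f k‖) ν ≤ C / (ν : ℝ) ^ 4) →
      (Summable fun ν : ℕ => Real.sqrt (blockSum n b τ (fun k => ‖f k‖) ν)) ∧
      ¬ Summable fun k : Fin n → ℤ =>
          ‖f k‖ ^ 2 * knorm k ^ ((2 * (⌊τ⌋₊ + 2) : ℕ) : ℝ) :=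
    fun f c C hc _ h =>
      ⟨summable_sqrt_of_eventually_le _ C (h.mono fun _ hν => hν.2),
        not_summable_of_blockSum_ge hb hs (fun k => ‖f k‖) hc (h.mono fun _ hν => hν.1)⟩
  obtain ⟨f, hf⟩ := exists_blockSum_eq (n := n) (by omega) hb τ
    (fun ν : ℕ => 1 / (ν : ℝ) ^ 4) (fun ν => by positivity)
  exact ⟨⟨f, key f 1 1 one_pos one_pos (.of_forall fun ν => ⟨(hf ν).ge, (hf ν).le⟩)⟩, key⟩
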